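/- Let Ω ⊂ ℝ⁴ be a connected open set, λ > 0, and let v ∈ C⁴(Ω) be a convex solution of equation (★). Suppose the Hessian ∇²v attains its minimal rank over Ω, equal to 3, at some point x₀ ∈ Ω (so rank(∇²v(x)) ≥ 3 for all x ∈ Ω and rank(∇²v(x₀)) = 3). Set φ(x) = det(∇²v(x)). Then there exist an open neighborhood O ⊂ Ω of x₀ and a constant C > 0, independent of φ, such that ∑_{i,j=1}^4 F^{ij}(x) φ_{ij}(x) ≤ C(φ(x) + |∇φ(x)|) for all x ∈ O. -/

import Mathlib

/-- First-order real partial derivative `∂f/∂xᵢ` on `ℝ⁴ ≅ ℂ²`. -/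
noncomputable def pd (f : (Fin 4 → ℝ) → ℝ) (i : Fin 4) (x : Fin 4 → ℝ) : ℝ :=
  fderiv ℝ f x (Pi.single i 1)

/-- Second-order real partial derivative `∂²f/∂xᵢ∂xⱼ`. -/
noncomputable def pd2 (f : (Fin 4 → ℝ) → ℝ) (i j : Fin 4) (x : Fin 4 → ℝ) : ℝ :=
  pd (fun y => pd f i y) j x

/-- The real Hessian matrix of `f` at `x`. -/
noncomputable def hessM (f : (Fin 4 → ℝ) → ℝ) (x : Fin 4 → ℝ) :
    Matrix (Fin 4) (Fin 4) ℝ :=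
  Matrix.of fun i j => pd2 f i j x

/-- Equation (★) (indices 1,2,3,4 are `0,1,2,3`). -/
def StarEq (lam : ℝ) (v : (Fin 4 → ℝ) → ℝ) (Ω : Set (Fin 4 → ℝ)) : Prop :=
  ∀ x ∈ Ω,
    (pd2 v 0 0 x + pd2 v 2 2 x) * (pd2 v 1 1 x + pd2 v 3 3 x)
      - (pd2 v 0 1 x + pd2 v 2 3 x)^2 - (pd2 v 0 3 x - pd2 v 1 2 x)^2
      - ((pd v 0 x)^2 + (pd v 2 x)^2) * (pd2 v 1 1 x + pd2 v 3 3 x)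
      - ((pd v 1 x)^2 + (pd v 3 x)^2) * (pd2 v 0 0 x + pd2 v 2 2 x)
      + 2 * (pd v 0 x * pd v 1 x + pd v 2 x * pd v 3 x) * (pd2 v 0 1 x + pd2 v 2 3 x)
      + 2 * (pd v 0 x * pd v 3 x - pd v 1 x * pd v 2 x) * (pd2 v 0 3 x - pd2 v 1 2 x)
      = lam

/-- The coefficient matrix `(F^{ij})` of the linearized operator of (★):
`F¹¹ = F³³ = v₂₂+v₄₄−(v₂²+v₄²)`, `F²² = F⁴⁴ = v₁₁+v₃₃−(v₁²+v₃²)`,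
`F¹² = F²¹ = F³⁴ = F⁴³ = (v₁v₂+v₃v₄)−(v₁₂+v₃₄)`,
`F¹⁴ = F⁴¹ = (v₁v₄−v₂v₃)−(v₁₄−v₂₃) = −F²³ = −F³²`, `F¹³ = F³¹ = F²⁴ = F⁴² = 0`. -/
noncomputable def Fm (v : (Fin 4 → ℝ) → ℝ) (x : Fin 4 → ℝ) :
    Matrix (Fin 4) (Fin 4) ℝ :=
  let a := pd2 v 1 1 x + pd2 v 3 3 x - ((pd v 1 x)^2 + (pd v 3 x)^2)
  let b := pd2 v 0 0 x + pd2 v 2 2 x - ((pd v 0 x)^2 + (pd v 2 x)^2)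
  let c := (pd v 0 x * pd v 1 x + pd v 2 x * pd v 3 x) - (pd2 v 0 1 x + pd2 v 2 3 x)
  let d := (pd v 0 x * pd v 3 x - pd v 1 x * pd v 2 x) - (pd2 v 0 3 x - pd2 v 1 2 x)
  !![a, c, 0, d;
     c, b, -d, 0;
     0, -d, a, c;
     d, 0, c, b]

/-- `σ₃` of a `4×4` matrix: the third elementary symmetric function of its
eigenvalues, i.e. the trace of the adjugate. -/
noncomputable def sigma3 (A : Matrix (Fin 4) (Fin 4) ℝ) : ℝ :=
  A.adjugate.trace

/-- Bian–Guan's quotient-type auxiliary function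
`φ = σ₃(∇²v) + q`, with `q = σ₄(∇²v)/σ₃(∇²v)` if `σ₃(∇²v) > 0` and `q = 0` otherwise. -/
noncomputable def phiBG (v : (Fin 4 → ℝ) → ℝ) (x : Fin 4 → ℝ) : ℝ :=
  sigma3 (hessM v x) +
    (if 0 < sigma3 (hessM v x) then (hessM v x).det / sigma3 (hessM v x) else 0)

section Calculus

variable {Ω : Set (Fin 4 → ℝ)} {f g : (Fin 4 → ℝ) → ℝ} {x : Fin 4 → ℝ}

theorem pd_add (i : Fin 4) (hf : DifferentiableAt ℝ f x) (hg : DifferentiableAt ℝ g x) :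
    pd (fun y => f y + g y) i x = pd f i x + pd g i x := by
  simp [pd, fderiv_fun_add hf hg]

theorem pd_sub (i : Fin 4) (hf : DifferentiableAt ℝ f x) (hg : DifferentiableAt ℝ g x) :
    pd (fun y => f y - g y) i x = pd f i x - pd g i x := by
  simp [pd, fderiv_fun_sub hf hg]

theorem pd_mul (i : Fin 4) (hf : DifferentiableAt ℝ f x) (hg : DifferentiableAt ℝ g x) :
    pd (fun y => f y * g y) i x = pd f i x * g x + f x * pd g i x := by
  simp [pd, fderiv_fun_mul hf hg]
  ring

theorem pd_sum {F : Fin 4 → (Fin 4 → ℝ) → ℝ} (i : Fin 4)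
    (hF : ∀ k, DifferentiableAt ℝ (F k) x) :
    pd (fun y => ∑ k, F k y) i x = ∑ k, pd (F k) i x := by
  simp [pd, fderiv_fun_sum (fun k _ => hF k)]

theorem pd_congr (hΩ : IsOpen Ω) (h : Set.EqOn f g Ω) (i : Fin 4) :
    Set.EqOn (pd f i) (pd g i) Ω := by
  intro x hx
  simp only [pd]
  rw [(h.eventuallyEq_of_mem (hΩ.mem_nhds hx)).fderiv_eq]

theorem ContDiffOn.pd (hΩ : IsOpen Ω) {m n : WithTop ℕ∞} (hf : ContDiffOn ℝ n f Ω)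
    (hmn : m + 1 ≤ n) (i : Fin 4) : ContDiffOn ℝ m (pd f i) Ω :=
  (hf.fderiv_of_isOpen hΩ hmn).clm_apply contDiffOn_const

theorem pd_pd_eq_fderiv (hΩ : IsOpen Ω) (hf : ContDiffOn ℝ 2 f Ω) (i j : Fin 4) (hx : x ∈ Ω) :
    pd (pd f i) j x =
      fderiv ℝ (fderiv ℝ f) x (Pi.single j 1) (Pi.single i 1) := by
  have h1 : DifferentiableAt ℝ (fderiv ℝ f) x :=
    ((hf.fderiv_of_isOpen hΩ (m := 1) (by norm_num)).contDiffAt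
      (hΩ.mem_nhds hx)).differentiableAt (by norm_num)
  change fderiv ℝ (fun y => fderiv ℝ f y (Pi.single i 1)) x (Pi.single j 1) = _
  rw [fderiv_clm_apply h1 (differentiableAt_const _)]
  simp

theorem pd_comm (hΩ : IsOpen Ω) (hf : ContDiffOn ℝ 2 f Ω) (i j : Fin 4) :
    Set.EqOn (pd (pd f i) j) (pd (pd f j) i) Ω := by
  intro x hx
  rw [pd_pd_eq_fderiv hΩ hf i j hx, pd_pd_eq_fderiv hΩ hf j i hx]
  exact ((hf.contDiffAt (hΩ.mem_nhds hx)).isSymmSndFDerivAt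
    (by rw [minSmoothness_of_isRCLikeNormedField])).eq _ _

theorem ContDiffOn.differentiableAt_of_isOpen (hΩ : IsOpen Ω) {n : WithTop ℕ∞}
    (hf : ContDiffOn ℝ n f Ω) (hn : n ≠ 0) (hx : x ∈ Ω) : DifferentiableAt ℝ f x :=
  (hf.contDiffAt (hΩ.mem_nhds hx)).differentiableAt hn

theorem pd2_mul (hΩ : IsOpen Ω) (hf : ContDiffOn ℝ 2 f Ω) (hg : ContDiffOn ℝ 2 g Ω)
    (i j : Fin 4) (hx : x ∈ Ω) :
    pd (pd (fun y => f y * g y) i) j x =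
      pd (pd f i) j x * g x + pd f i x * pd g j x + pd f j x * pd g i x
        + f x * pd (pd g i) j x := by
  have h2 : (2 : WithTop ℕ∞) ≠ 0 := by norm_num
  have h21 : (1 : WithTop ℕ∞) + 1 ≤ 2 := by norm_num
  have hE : Set.EqOn (pd (fun y => f y * g y) i)
      (fun y => pd f i y * g y + f y * pd g i y) Ω := fun y hy =>
    pd_mul i (hf.differentiableAt_of_isOpen hΩ h2 hy) (hg.differentiableAt_of_isOpen hΩ h2 hy)
  have df := hf.differentiableAt_of_isOpen hΩ h2 hx
  have dg := hg.differentiableAt_of_isOpen hΩ h2 hx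
  have dfi := (hf.pd hΩ h21 i).differentiableAt_of_isOpen hΩ one_ne_zero hx
  have dgi := (hg.pd hΩ h21 i).differentiableAt_of_isOpen hΩ one_ne_zero hx
  rw [pd_congr hΩ hE j hx, pd_add j (dfi.fun_mul dg) (df.fun_mul dgi), pd_mul j dfi dg, pd_mul j df dgi]
  ring

/-- The first derivative of `f` at `x` in the direction `n`. -/
noncomputable def dirD (n : Fin 4 → ℝ) (f : (Fin 4 → ℝ) → ℝ) (x : Fin 4 → ℝ) : ℝ :=
  ∑ k, n k * pd f k x

/-- The second derivative of `f` at `x` in the direction `n`. -/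
noncomputable def dirD2 (n : Fin 4 → ℝ) (f : (Fin 4 → ℝ) → ℝ) (x : Fin 4 → ℝ) : ℝ :=
  ∑ k, ∑ l, n k * n l * pd (pd f k) l x

variable (n : Fin 4 → ℝ)

theorem dirD_add (hf : DifferentiableAt ℝ f x) (hg : DifferentiableAt ℝ g x) :
    dirD n (fun y => f y + g y) x = dirD n f x + dirD n g x := by
  simp only [dirD, pd_add _ hf hg, mul_add, Finset.sum_add_distrib]

theorem dirD_sub (hf : DifferentiableAt ℝ f x) (hg : DifferentiableAt ℝ g x) :
    dirD n (fun y => f y - g y) x = dirD n f x - dirD n g x := by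
  simp only [dirD, pd_sub _ hf hg, mul_sub, Finset.sum_sub_distrib]

theorem dirD_mul (hf : DifferentiableAt ℝ f x) (hg : DifferentiableAt ℝ g x) :
    dirD n (fun y => f y * g y) x = dirD n f x * g x + f x * dirD n g x := by
  simp only [dirD, pd_mul _ hf hg, mul_add, Finset.sum_add_distrib, Finset.sum_mul, Finset.mul_sum]
  congr 1 <;> exact Finset.sum_congr rfl fun _ _ => by ring

theorem dirD2_add (hΩ : IsOpen Ω) (hf : ContDiffOn ℝ 2 f Ω) (hg : ContDiffOn ℝ 2 g Ω)
    (hx : x ∈ Ω) :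
    dirD2 n (fun y => f y + g y) x = dirD2 n f x + dirD2 n g x := by
  have h2 : (2 : WithTop ℕ∞) ≠ 0 := by norm_num
  have h21 : (1 : WithTop ℕ∞) + 1 ≤ 2 := by norm_num
  have key : ∀ k l, pd (pd (fun y => f y + g y) k) l x = pd (pd f k) l x + pd (pd g k) l x := by
    intro k l
    have hE : Set.EqOn (pd (fun y => f y + g y) k) (fun y => pd f k y + pd g k y) Ω := fun y hy =>
      pd_add k (hf.differentiableAt_of_isOpen hΩ h2 hy) (hg.differentiableAt_of_isOpen hΩ h2 hy)
    rw [pd_congr hΩ hE l hx, pd_add l ((hf.pd hΩ h21 k).differentiableAt_of_isOpen hΩ one_ne_zero hx)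
      ((hg.pd hΩ h21 k).differentiableAt_of_isOpen hΩ one_ne_zero hx)]
  simp only [dirD2, key, mul_add, Finset.sum_add_distrib]

theorem dirD2_sub (hΩ : IsOpen Ω) (hf : ContDiffOn ℝ 2 f Ω) (hg : ContDiffOn ℝ 2 g Ω)
    (hx : x ∈ Ω) :
    dirD2 n (fun y => f y - g y) x = dirD2 n f x - dirD2 n g x := by
  have h := dirD2_add n hΩ (hf.sub hg) hg hx
  simp only [sub_add_cancel] at h
  exact eq_sub_of_add_eq h.symm

theorem dirD2_mul (hΩ : IsOpen Ω) (hf : ContDiffOn ℝ 2 f Ω) (hg : ContDiffOn ℝ 2 g Ω)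
    (hx : x ∈ Ω) :
    dirD2 n (fun y => f y * g y) x =
      dirD2 n f x * g x + 2 * dirD n f x * dirD n g x + f x * dirD2 n g x := by
  simp only [dirD2, dirD, pd2_mul hΩ hf hg _ _ hx, Fin.sum_univ_four]
  ring

theorem dirD_congr_const (hΩ : IsOpen Ω) {c : ℝ} (h : Set.EqOn f (fun _ => c) Ω) (hx : x ∈ Ω) :
    dirD n f x = 0 := by
  have : ∀ k, pd f k x = 0 := fun k => by rw [pd_congr hΩ h k hx]; simp [pd]
  simp [dirD, this]

theorem dirD2_congr_const (hΩ : IsOpen Ω) {c : ℝ} (h : Set.EqOn f (fun _ => c) Ω) (hx : x ∈ Ω) :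
    dirD2 n f x = 0 := by
  have h1 : ∀ k, Set.EqOn (pd f k) (fun _ => 0) Ω := fun k y hy => by
    rw [pd_congr hΩ h k hy]; simp [pd]
  have : ∀ k l, pd (pd f k) l x = 0 := fun k l => by rw [pd_congr hΩ (h1 k) l hx]; simp [pd]
  simp [dirD2, this]

theorem dirD_dirD_nonneg_of_convexOn (hΩ : IsOpen Ω) (hf : ContDiffOn ℝ 2 f Ω)
    (hconv : ConvexOn ℝ Ω f) (hx : x ∈ Ω) : 0 ≤ dirD2 n f x := by
  set γ : ℝ → (Fin 4 → ℝ) := fun t => x + t • n with hγ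
  have hγd : ∀ t, HasDerivAt γ n t := fun t => by
    have h := ((hasDerivAt_id t).smul_const n).const_add x
    rwa [one_smul] at h
  have hγc : Continuous γ := continuous_iff_continuousAt.2 fun t => (hγd t).continuousAt
  have hSo : IsOpen (γ ⁻¹' Ω) := hΩ.preimage hγc
  have h0 : (0 : ℝ) ∈ γ ⁻¹' Ω := by simpa [hγ] using hx
  have hcv : ConvexOn ℝ (γ ⁻¹' Ω) (f ∘ γ) := by
    have := hconv.comp_affineMap (AffineMap.lineMap x (x + n))
    have e : (AffineMap.lineMap x (x + n) : ℝ → (Fin 4 → ℝ)) = γ := by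
      ext t; simp [AffineMap.lineMap_apply, hγ, add_comm]
    rwa [e] at this
  have hfd : ∀ t ∈ γ ⁻¹' Ω, HasDerivAt (f ∘ γ) (fderiv ℝ f (γ t) n) t := fun t ht =>
    (hf.differentiableAt_of_isOpen hΩ (by norm_num) ht).hasFDerivAt.comp_hasDerivAt t (hγd t)
  have hmono := hcv.monotoneOn_deriv fun t ht => (hfd t ht).differentiableAt
  have hpos := hmono.derivWithin_nonneg (x := 0)
  have h1 : DifferentiableAt ℝ (fderiv ℝ f) (γ 0) :=
    ((hf.fderiv_of_isOpen hΩ (m := 1) (by norm_num)).contDiffAt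
      (hΩ.mem_nhds h0)).differentiableAt (by norm_num)
  have hev : deriv (f ∘ γ) =ᶠ[nhds 0] fun t => fderiv ℝ f (γ t) n := by
    filter_upwards [hSo.mem_nhds h0] with t ht using (hfd t ht).deriv
  have hd2 : HasDerivAt (fun t => fderiv ℝ f (γ t) n) (fderiv ℝ (fderiv ℝ f) (γ 0) n n) 0 := by
    have := (h1.hasFDerivAt.comp_hasDerivAt 0 (hγd 0)).clm_apply (hasDerivAt_const 0 n)
    simpa using this
  rw [derivWithin_of_isOpen hSo h0, hev.deriv_eq, hd2.deriv] at hpos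
  have hn : n = ∑ k, n k • (Pi.single k (1 : ℝ) : Fin 4 → ℝ) := by
    ext i; simp [Finset.sum_apply, Pi.single_apply]
  have hγ0 : γ 0 = x := by simp [hγ]
  rw [hγ0] at hpos
  have : fderiv ℝ (fderiv ℝ f) x n n = dirD2 n f x := by
    conv_lhs => rw [hn]
    simp only [map_sum, map_smul, sum_apply, smul_apply, dirD2,
      pd_pd_eq_fderiv hΩ hf _ _ hx, Finset.mul_sum, smul_eq_mul, mul_assoc]
  rwa [this] at hpos

end Calculus

section HermitianForms

open Matrix

/-- The real `4×4` matrix representing, in the coordinates `(x₁, x₂, x₃, x₄)` of `ℂ²`, the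
Hermitian matrix with diagonal `a, b` and off-diagonal entries `c ± i d`. -/
def hermReal (a b c d : ℝ) : Matrix (Fin 4) (Fin 4) ℝ :=
  !![a, c, 0, d;
     c, b, -d, 0;
     0, -d, a, c;
     d, 0, c, b]

/-- Multiplication by `i` on `ℂ² ≅ ℝ⁴`. -/
def mulI (q : Fin 4 → ℝ) : Fin 4 → ℝ := ![-q 2, -q 3, q 0, q 1]

/-- The (unnormalised) Hermitian part of a symmetric real matrix. -/
def hermPart (X : Matrix (Fin 4) (Fin 4) ℝ) : Matrix (Fin 4) (Fin 4) ℝ :=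
  hermReal (X 0 0 + X 2 2) (X 1 1 + X 3 3) (X 0 1 + X 2 3) (X 0 3 - X 1 2)

/-- The complex determinant of the Hermitian part of a symmetric real matrix. -/
def hermDet (X : Matrix (Fin 4) (Fin 4) ℝ) : ℝ :=
  (X 0 0 + X 2 2) * (X 1 1 + X 3 3) - (X 0 1 + X 2 3) ^ 2 - (X 0 3 - X 1 2) ^ 2

theorem exists_unit_complex_orthogonal (p : Fin 4 → ℝ) :
    ∃ q : Fin 4 → ℝ, q ⬝ᵥ q = 1 ∧ p ⬝ᵥ q = 0 ∧ p ⬝ᵥ mulI q = 0 := by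
  by_cases hp : p ⬝ᵥ p = 0
  · have : p = 0 := dotProduct_self_eq_zero.1 hp
    exact ⟨Pi.single 0 1, by simp, by simp [this], by simp [this]⟩
  · have hpos : 0 < p ⬝ᵥ p := lt_of_le_of_ne
      (Finset.sum_nonneg fun i _ => mul_self_nonneg _) (Ne.symm hp)
    set r := Real.sqrt (p ⬝ᵥ p) with hr
    have hrr : r * r = p ⬝ᵥ p := Real.mul_self_sqrt hpos.le
    have hr0 : r ≠ 0 := (Real.sqrt_pos.2 hpos).ne'
    refine ⟨r⁻¹ • ![-p 1, p 0, p 3, -p 2], ?_, ?_, ?_⟩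
    · rw [smul_dotProduct, dotProduct_smul]
      have : ![-p 1, p 0, p 3, -p 2] ⬝ᵥ ![-p 1, p 0, p 3, -p 2] = r * r := by
        rw [hrr]; simp [dotProduct, Fin.sum_univ_four]; ring
      rw [this]; simp [smul_eq_mul]; field_simp
    · rw [dotProduct_smul]; simp [dotProduct, Fin.sum_univ_four]; right; ring
    · simp [dotProduct, Fin.sum_univ_four, mulI]; ring

theorem dotProduct_hermPart_mulVec {H : Matrix (Fin 4) (Fin 4) ℝ} (hH : H.IsSymm)
    (q : Fin 4 → ℝ) :
    q ⬝ᵥ hermPart H *ᵥ q = q ⬝ᵥ H *ᵥ q + mulI q ⬝ᵥ H *ᵥ mulI q := by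
  have h := fun i j => hH.apply i j
  simp [dotProduct, mulVec, Fin.sum_univ_four, hermPart, hermReal, mulI]
  rw [h 0 1, h 0 2, h 0 3, h 1 2, h 1 3, h 2 3]
  ring

variable {a b c d : ℝ}

theorem trace_hermReal_mul (K : Matrix (Fin 4) (Fin 4) ℝ) :
    trace (hermReal a b c d * K) = a * (K 0 0 + K 2 2) + b * (K 1 1 + K 3 3)
      + c * (K 0 1 + K 1 0 + K 2 3 + K 3 2) + d * (K 0 3 + K 3 0 - K 1 2 - K 2 1) := by
  simp only [trace, diag_apply, Matrix.mul_apply, Fin.sum_univ_four, hermReal]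
  simp
  ring

theorem pos_of_dotProduct_nonneg (hdet : 0 < a * b - c ^ 2 - d ^ 2) {q : Fin 4 → ℝ}
    (hq : q ⬝ᵥ q = 1) (hnn : 0 ≤ q ⬝ᵥ hermReal a b c d *ᵥ q) :
    0 < a ∧ 0 < b ∧ a * b - c ^ 2 - d ^ 2 ≤ (a + b) * (q ⬝ᵥ hermReal a b c d *ᵥ q) := by
  have hq' : q 0 * q 0 + q 1 * q 1 + q 2 * q 2 + q 3 * q 3 = 1 := by
    rw [← hq]; simp [dotProduct, Fin.sum_univ_four]
  have hab : 0 < a * b := by nlinarith [sq_nonneg c, sq_nonneg d]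
  have hkey : (a + b) * (q ⬝ᵥ hermReal a b c d *ᵥ q) =
      (a * q 0 + c * q 1 + d * q 3) ^ 2 + (a * q 2 - d * q 1 + c * q 3) ^ 2
        + (c * q 0 + b * q 1 - d * q 2) ^ 2 + (d * q 0 + c * q 2 + b * q 3) ^ 2
        + (a * b - c ^ 2 - d ^ 2) := by
    have : (a * b - c ^ 2 - d ^ 2) = (a * b - c ^ 2 - d ^ 2) *
      (q 0 * q 0 + q 1 * q 1 + q 2 * q 2 + q 3 * q 3) := by rw [hq', mul_one]
    rw [this]
    simp [dotProduct, mulVec, Fin.sum_univ_four, hermReal]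
    ring
  have hle : a * b - c ^ 2 - d ^ 2 ≤ (a + b) * (q ⬝ᵥ hermReal a b c d *ᵥ q) := by
    rw [hkey]
    have := sq_nonneg (a * q 0 + c * q 1 + d * q 3)
    have := sq_nonneg (a * q 2 - d * q 1 + c * q 3)
    have := sq_nonneg (c * q 0 + b * q 1 - d * q 2)
    have := sq_nonneg (d * q 0 + c * q 2 + b * q 3)
    linarith
  have hs : 0 < a + b := pos_of_mul_pos_left (hdet.trans_le hle) hnn
  have ha : 0 < a := by
    by_contra! h
    have : b ≤ 0 := by
      by_contra! hb
      nlinarith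
    linarith
  exact ⟨ha, pos_of_mul_pos_right hab ha.le, hle⟩

theorem trace_hermReal_mul_nonneg (ha : 0 < a) (hdet : 0 ≤ a * b - c ^ 2 - d ^ 2)
    {H : Matrix (Fin 4) (Fin 4) ℝ} (hH : H.PosSemidef) (Z : Matrix (Fin 4) (Fin 4) ℝ) :
    0 ≤ trace (hermReal a b c d * (Zᵀ * H * Z)) := by
  set K := Zᵀ * H * Z with hK
  have hKp : K.PosSemidef := by
    simpa [hK] using hH.conjTranspose_mul_mul_same Z
  have hKs : ∀ i j, K j i = K i j := fun i j => by simpa using hKp.1.apply i j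
  have h1 := hKp.dotProduct_mulVec_nonneg ![a, c, 0, d]
  have h2 := hKp.dotProduct_mulVec_nonneg ![0, -d, a, c]
  have h3 := hKp.dotProduct_mulVec_nonneg ![0, 1, 0, 0]
  have h4 := hKp.dotProduct_mulVec_nonneg ![0, 0, 0, 1]
  have key : a * trace (hermReal a b c d * K) =
      star ![a, c, 0, d] ⬝ᵥ K *ᵥ ![a, c, 0, d] + star ![0, -d, a, c] ⬝ᵥ K *ᵥ ![0, -d, a, c]
      + (a * b - c ^ 2 - d ^ 2) * (star ![0, 1, 0, 0] ⬝ᵥ K *ᵥ ![0, 1, 0, 0]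
        + star ![0, 0, 0, 1] ⬝ᵥ K *ᵥ ![0, 0, 0, 1]) := by
    simp [dotProduct, mulVec, Fin.sum_univ_four, trace_hermReal_mul]
    rw [hKs 0 1, hKs 0 3, hKs 1 2, hKs 1 3, hKs 2 3]
    ring
  have : 0 ≤ a * trace (hermReal a b c d * K) := by
    rw [key]
    have := mul_nonneg hdet (add_nonneg h3 h4)
    linarith
  exact nonneg_of_mul_nonneg_right this ha

/-- The complex-linear rank one matrix `q ⊗ y*`. -/
def complexRankOne (q y : Fin 4 → ℝ) : Matrix (Fin 4) (Fin 4) ℝ :=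
  Matrix.of fun i j => q i * y j + mulI q i * mulI y j

theorem trace_hermReal_mul_transpose_mul {X : Matrix (Fin 4) (Fin 4) ℝ} (hX : X.IsSymm)
    (q y : Fin 4 → ℝ) :
    trace (hermReal a b c d * ((complexRankOne q y)ᵀ * X)) =
      (hermPart X *ᵥ q) ⬝ᵥ hermReal a b c d *ᵥ y := by
  have h := fun i j => hX.apply i j
  simp [trace_hermReal_mul, Matrix.mul_apply, transpose_apply, Fin.sum_univ_four,
    complexRankOne]
  simp [dotProduct, mulVec, Fin.sum_univ_four, hermReal, hermPart, mulI]
  rw [h 0 1, h 0 2, h 0 3, h 1 2, h 1 3, h 2 3]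
  ring

theorem trace_hermReal_mul_conj {H : Matrix (Fin 4) (Fin 4) ℝ} (hH : H.IsSymm)
    (q y : Fin 4 → ℝ) :
    trace (hermReal a b c d * ((complexRankOne q y)ᵀ * H * complexRankOne q y)) =
      (q ⬝ᵥ hermPart H *ᵥ q) * (y ⬝ᵥ hermReal a b c d *ᵥ y) := by
  have h := fun i j => hH.apply i j
  simp [trace_hermReal_mul, Matrix.mul_apply, transpose_apply, Fin.sum_univ_four,
    complexRankOne]
  simp [dotProduct, mulVec, Fin.sum_univ_four, hermReal, hermPart, mulI]
  rw [h 0 1, h 0 2, h 0 3, h 1 2, h 1 3, h 2 3]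
  ring

/-- The `2×2` Hermitian identity `X adj(W) X = tr(adj(W) X) X - det(X) W`. -/
theorem hermPart_mul_hermReal_mul_hermPart {X : Matrix (Fin 4) (Fin 4) ℝ} (hX : X.IsSymm)
    (q : Fin 4 → ℝ) :
    (hermPart X *ᵥ q) ⬝ᵥ hermReal a b c d *ᵥ (hermPart X *ᵥ q) =
      trace (hermReal a b c d * X) * (q ⬝ᵥ hermPart X *ᵥ q)
        - hermDet X * (q ⬝ᵥ hermReal b a (-c) (-d) *ᵥ q) := by
  have h := fun i j => hX.apply i j
  rw [trace_hermReal_mul]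
  simp [dotProduct, mulVec, Fin.sum_univ_four, hermReal, hermPart, hermDet]
  rw [h 0 1, h 0 3, h 1 2, h 2 3]
  ring

theorem neg_trace_conj_le (ha : 0 < a) (hdet : 0 ≤ a * b - c ^ 2 - d ^ 2)
    {H X U E : Matrix (Fin 4) (Fin 4) ℝ} (hH : H.PosSemidef) (hX : X.IsSymm)
    (hHU : H * U = E - X) (q : Fin 4 → ℝ) {s : ℝ} (hs : s * (q ⬝ᵥ hermPart H *ᵥ q) = 1)
    (hW : q ⬝ᵥ hermPart H *ᵥ q = q ⬝ᵥ hermReal b a (-c) (-d) *ᵥ q) :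
    -trace (hermReal a b c d * (Uᵀ * H * U)) ≤
      2 * trace (hermReal a b c d * ((s • complexRankOne q (hermPart X *ᵥ q))ᵀ * E))
        - s * (trace (hermReal a b c d * X) * (q ⬝ᵥ hermPart X *ᵥ q)) + hermDet X := by
  set F := hermReal a b c d with hF
  set y := hermPart X *ᵥ q with hy
  set V := s • complexRankOne q y with hV
  have hHs : H.IsSymm := by simpa [IsHermitian, IsSymm] using hH.1
  have hFs : Fᵀ = F := by
    ext i j; fin_cases i <;> fin_cases j <;> rfl
  have h0 := trace_hermReal_mul_nonneg (b := b) (c := c) (d := d) ha hdet hH (U + V)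
  have hcross : trace (F * (Uᵀ * H * V)) = trace (F * (Vᵀ * H * U)) := by
    rw [← trace_transpose (F * (Uᵀ * H * V))]
    simp only [transpose_mul, transpose_transpose, hFs, hHs.eq]
    rw [trace_mul_comm]
    simp only [Matrix.mul_assoc]
  have hexp : trace (F * ((U + V)ᵀ * H * (U + V))) = trace (F * (Uᵀ * H * U))
      + 2 * trace (F * (Vᵀ * H * U)) + trace (F * (Vᵀ * H * V)) := by
    simp only [transpose_add, Matrix.add_mul, Matrix.mul_add, trace_add, hcross]
    ring
  have h1 : trace (F * (Vᵀ * H * U)) = trace (F * (Vᵀ * E)) - s * (y ⬝ᵥ F *ᵥ y) := by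
    rw [Matrix.mul_assoc, hHU, Matrix.mul_sub, Matrix.mul_sub, trace_sub]
    congr 1
    rw [hV, transpose_smul, Matrix.smul_mul, Matrix.mul_smul, trace_smul, hF,
      trace_hermReal_mul_transpose_mul hX, smul_eq_mul]
  have h2 : trace (F * (Vᵀ * H * V)) = s * (y ⬝ᵥ F *ᵥ y) := by
    have : F * (Vᵀ * H * V) = (s * s) •
        (F * ((complexRankOne q y)ᵀ * H * complexRankOne q y)) := by
      simp only [hV, transpose_smul, Matrix.smul_mul, Matrix.mul_smul, smul_smul]
    rw [this, trace_smul, hF, trace_hermReal_mul_conj hHs, smul_eq_mul]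
    linear_combination (s * (y ⬝ᵥ hermReal a b c d *ᵥ y)) * hs
  have h3 : s * (y ⬝ᵥ F *ᵥ y) =
      s * (trace (F * X) * (q ⬝ᵥ hermPart X *ᵥ q)) - hermDet X := by
    rw [hy, hF, hermPart_mul_hermReal_mul_hermPart hX, ← hW]
    linear_combination (-hermDet X) * hs
  rw [← hF, hexp, h1, h2] at h0
  linarith

end HermitianForms

section RankThree

open Matrix

theorem exists_adjugate_diag_pos {H : Matrix (Fin 4) (Fin 4) ℝ} (hH : H.PosSemidef)
    (hr : H.rank = 3) : ∃ m, 0 < H.adjugate m m := by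
  have hdet : H.det = 0 := by
    by_contra h
    have := rank_of_isUnit H ((isUnit_iff_isUnit_det H).2 (isUnit_iff_ne_zero.2 h))
    simp [hr] at this
  obtain ⟨k, hk0, hk⟩ := exists_mulVec_eq_zero_iff.2 hdet
  obtain ⟨m, hm⟩ := Function.ne_iff.1 hk0
  have hker : Module.finrank ℝ (LinearMap.ker H.mulVecLin) = 1 := by
    have h1 := LinearMap.finrank_range_add_finrank_ker H.mulVecLin
    rw [← Matrix.rank, hr] at h1
    simp at h1
    omega
  have hone : ∀ z, H *ᵥ z = 0 → z m = 0 → z = 0 := by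
    intro z hz hzm
    have hk' : (⟨k, by simpa using hk⟩ : LinearMap.ker H.mulVecLin) ≠ 0 := by
      simpa [Subtype.ext_iff] using hk0
    obtain ⟨c, hc⟩ := (finrank_eq_one_iff_of_nonzero' _ hk').1 hker ⟨z, by simpa using hz⟩
    have hc' : c • k = z := congrArg Subtype.val hc
    have : c * k m = 0 := by rw [← hzm, ← hc']; rfl
    have hc0 : c = 0 := (mul_eq_zero.1 this).resolve_right hm
    rw [← hc', hc0, zero_smul]
  refine ⟨m, ?_⟩
  have hpd : (H + Matrix.single m m (1 : ℝ)).PosDef := by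
    refine PosDef.of_dotProduct_mulVec_pos (hH.1.add (by simp [IsHermitian])) fun z hz => ?_
    have h1 := hH.dotProduct_mulVec_nonneg z
    have h2 : star z ⬝ᵥ (H + Matrix.single m m (1 : ℝ)) *ᵥ z = star z ⬝ᵥ H *ᵥ z + z m * z m := by
      rw [add_mulVec, dotProduct_add]
      congr 1
      simp [dotProduct, mulVec, Matrix.single_apply, ite_and, Finset.sum_ite_eq]
    rw [h2]
    refine lt_of_le_of_ne (add_nonneg h1 (mul_self_nonneg _)) fun h0 => hz ?_
    have h3 : z m * z m = 0 := by nlinarith [mul_self_nonneg (z m)]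
    have h4 : star z ⬝ᵥ H *ᵥ z = 0 := by linarith
    exact hone z ((hH.dotProduct_mulVec_zero_iff z).1 h4) (mul_self_eq_zero.1 h3)
  have hupd : H + Matrix.single m m (1 : ℝ) = H.updateRow m (H m + Pi.single m 1) := by
    ext i j
    by_cases hi : i = m
    · subst hi; simp [Matrix.single_apply, Pi.single_apply, eq_comm]
    · simp [updateRow_ne hi, Ne.symm hi]
  have := hpd.det_pos
  rwa [hupd, det_updateRow_add, updateRow_eq_self, hdet, zero_add, ← adjugate_apply] at this

end RankThree

section BigO

open Asymptotics Matrix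

variable {α : Type*} {l : Filter α} {ψ : α → ℝ}

theorem Asymptotics.IsBigO.bdd_mul {f g : α → ℝ} (hf : f =O[l] (1 : α → ℝ)) (hg : g =O[l] ψ) :
    (fun x => f x * g x) =O[l] ψ := by
  simpa using hf.mul hg

theorem isBigO_trace_mul {A B : α → Matrix (Fin 4) (Fin 4) ℝ}
    (hA : ∀ i j, (fun x => A x i j) =O[l] (1 : α → ℝ)) (hB : ∀ i j, (fun x => B x i j) =O[l] ψ) :
    (fun x => trace (A x * B x)) =O[l] ψ := by
  simp only [trace, diag_apply, Matrix.mul_apply]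
  exact .fun_sum fun i _ => .fun_sum fun j _ => (hA i j).bdd_mul (hB j i)

theorem isBigO_mul_apply {A B : α → Matrix (Fin 4) (Fin 4) ℝ}
    (hA : ∀ i j, (fun x => A x i j) =O[l] (1 : α → ℝ)) (hB : ∀ i j, (fun x => B x i j) =O[l] ψ)
    (i j : Fin 4) : (fun x => (A x * B x) i j) =O[l] ψ := by
  simp only [Matrix.mul_apply]
  exact .fun_sum fun k _ => (hA i k).bdd_mul (hB k j)

theorem isBigO_mulVec_apply {A : α → Matrix (Fin 4) (Fin 4) ℝ} {q : α → Fin 4 → ℝ}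
    (hA : ∀ i j, (fun x => A x i j) =O[l] (1 : α → ℝ)) (hq : ∀ i, (fun x => q x i) =O[l] ψ)
    (i : Fin 4) : (fun x => (A x *ᵥ q x) i) =O[l] ψ := by
  simp only [mulVec, dotProduct]
  exact .fun_sum fun k _ => (hA i k).bdd_mul (hq k)

theorem isBigO_hermReal {a b c d : α → ℝ} (ha : a =O[l] ψ) (hb : b =O[l] ψ) (hc : c =O[l] ψ)
    (hd : d =O[l] ψ) (i j : Fin 4) :
    (fun x => hermReal (a x) (b x) (c x) (d x) i j) =O[l] ψ := by
  have h0 : (fun _ => (0 : ℝ)) =O[l] ψ := isBigO_zero _ _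
  fin_cases i <;> fin_cases j <;> simp [hermReal] <;> assumption

theorem isBigO_hermPart {X : α → Matrix (Fin 4) (Fin 4) ℝ}
    (hX : ∀ i j, (fun x => X x i j) =O[l] ψ) (i j : Fin 4) :
    (fun x => hermPart (X x) i j) =O[l] ψ :=
  isBigO_hermReal ((hX _ _).add (hX _ _)) ((hX _ _).add (hX _ _)) ((hX _ _).add (hX _ _))
    ((hX _ _).sub (hX _ _)) i j

theorem isBigO_hermDet_sub {X Y : α → Matrix (Fin 4) (Fin 4) ℝ}
    (hX : ∀ i j, (fun x => X x i j) =O[l] (1 : α → ℝ))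
    (hY : ∀ i j, (fun x => Y x i j) =O[l] (1 : α → ℝ))
    (hYψ : ∀ i j, (fun x => Y x i j) =O[l] ψ) :
    (fun x => hermDet (X x) - hermDet (X x - Y x)) =O[l] ψ := by
  have h : ∀ x, hermDet (X x) - hermDet (X x - Y x) =
      (X x 0 0 + X x 2 2) * (Y x 1 1 + Y x 3 3) + (X x 1 1 + X x 3 3 - (Y x 1 1 + Y x 3 3)) *
        (Y x 0 0 + Y x 2 2) - (2 * (X x 0 1 + X x 2 3) - (Y x 0 1 + Y x 2 3)) *
        (Y x 0 1 + Y x 2 3) - (2 * (X x 0 3 - X x 1 2) - (Y x 0 3 - Y x 1 2)) *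
        (Y x 0 3 - Y x 1 2) := fun x => by
    simp only [hermDet, Matrix.sub_apply]; ring
  simp only [h]
  refine (((((hX _ _).add (hX _ _)).bdd_mul ((hYψ _ _).add (hYψ _ _))).add ?_).sub ?_).sub ?_
  · exact (((hX _ _).add (hX _ _)).sub ((hY _ _).add (hY _ _))).bdd_mul ((hYψ _ _).add (hYψ _ _))
  · exact ((((hX _ _).add (hX _ _)).const_mul_left 2).sub ((hY _ _).add (hY _ _))).bdd_mul
      ((hYψ _ _).add (hYψ _ _))
  · exact ((((hX _ _).sub (hX _ _)).const_mul_left 2).sub ((hY _ _).sub (hY _ _))).bdd_mul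
      ((hYψ _ _).sub (hYψ _ _))

theorem isBigO_complexRankOne {q y : α → Fin 4 → ℝ}
    (hq : ∀ i, (fun x => q x i) =O[l] (1 : α → ℝ)) (hy : ∀ i, (fun x => y x i) =O[l] (1 : α → ℝ))
    (i j : Fin 4) : (fun x => complexRankOne (q x) (y x) i j) =O[l] (1 : α → ℝ) := by
  have hI : ∀ {r : α → Fin 4 → ℝ}, (∀ i, (fun x => r x i) =O[l] (1 : α → ℝ)) →
      ∀ i, (fun x => mulI (r x) i) =O[l] (1 : α → ℝ) := by
    intro r hr i
    have h0 := hr 0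
    have h1 := hr 1
    have h2 := (hr 2).neg_left
    have h3 := (hr 3).neg_left
    fin_cases i <;> simp only [mulI] <;> assumption
  exact ((hq i).bdd_mul (hy j)).add ((hI hq i).bdd_mul (hI hy j))

end BigO

section HessianDeterminant

open Matrix

variable {Ω : Set (Fin 4 → ℝ)} {v : (Fin 4 → ℝ) → ℝ} {x : Fin 4 → ℝ}

/-- The determinant of the Hessian. -/
noncomputable def hessDet (v : (Fin 4 → ℝ) → ℝ) (x : Fin 4 → ℝ) : ℝ := (hessM v x).det

/-- The `m`-th column of the cofactor matrix of the Hessian. -/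
noncomputable def cofCol (v : (Fin 4 → ℝ) → ℝ) (m k : Fin 4) (x : Fin 4 → ℝ) : ℝ :=
  (hessM v x).adjugate k m

/-- The first derivatives of the cofactor column. -/
noncomputable def cofColD (v : (Fin 4 → ℝ) → ℝ) (m : Fin 4) (x : Fin 4 → ℝ) :
    Matrix (Fin 4) (Fin 4) ℝ :=
  of fun k i => pd (cofCol v m k) i x

/-- The Hessian of the diagonal cofactor. -/
noncomputable def cofDiagD2 (v : (Fin 4 → ℝ) → ℝ) (m : Fin 4) (x : Fin 4 → ℝ) :
    Matrix (Fin 4) (Fin 4) ℝ :=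
  of fun i j => pd (pd (cofCol v m m) i) j x

/-- The matrix whose `m`-th row is the gradient of the Hessian determinant. -/
noncomputable def gradRow (v : (Fin 4 → ℝ) → ℝ) (m : Fin 4) (x : Fin 4 → ℝ) :
    Matrix (Fin 4) (Fin 4) ℝ :=
  of fun i j => if i = m then pd (hessDet v) j x else 0

/-- The derivative of the Hessian along the cofactor column. -/
noncomputable def hessD (v : (Fin 4 → ℝ) → ℝ) (m : Fin 4) (x : Fin 4 → ℝ) :
    Matrix (Fin 4) (Fin 4) ℝ :=
  of fun i j => dirD (fun k => cofCol v m k x) (pd (pd v i) j) x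

/-- The second derivative of the Hessian along the (frozen) cofactor column. -/
noncomputable def hessD2 (v : (Fin 4 → ℝ) → ℝ) (m : Fin 4) (x : Fin 4 → ℝ) :
    Matrix (Fin 4) (Fin 4) ℝ :=
  of fun i j => dirD2 (fun k => cofCol v m k x) (pd (pd v i) j) x

/-- The derivative of `∇v ⊗ ∇v` along the cofactor column. -/
noncomputable def gradSqD (v : (Fin 4 → ℝ) → ℝ) (m : Fin 4) (x : Fin 4 → ℝ) :
    Matrix (Fin 4) (Fin 4) ℝ :=
  of fun i j => dirD (fun k => cofCol v m k x) (fun y => pd v i y * pd v j y) x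

/-- The second derivative of `∇v ⊗ ∇v` along the (frozen) cofactor column. -/
noncomputable def gradSqD2 (v : (Fin 4 → ℝ) → ℝ) (m : Fin 4) (x : Fin 4 → ℝ) :
    Matrix (Fin 4) (Fin 4) ℝ :=
  of fun i j => dirD2 (fun k => cofCol v m k x) (fun y => pd v i y * pd v j y) x

theorem contDiffOn_pd (hΩ : IsOpen Ω) (hv : ContDiffOn ℝ 4 v Ω) (i : Fin 4) :
    ContDiffOn ℝ 3 (pd v i) Ω := hv.pd hΩ (by norm_num) i

theorem contDiffOn_pd2 (hΩ : IsOpen Ω) (hv : ContDiffOn ℝ 4 v Ω) (i j : Fin 4) :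
    ContDiffOn ℝ 2 (pd (pd v i) j) Ω := (contDiffOn_pd hΩ hv i).pd hΩ (by norm_num) j

theorem contDiffOn_pd3 (hΩ : IsOpen Ω) (hv : ContDiffOn ℝ 4 v Ω) (i j k : Fin 4) :
    ContDiffOn ℝ 1 (pd (pd (pd v i) j) k) Ω := (contDiffOn_pd2 hΩ hv i j).pd hΩ (by norm_num) k

theorem ContDiffOn.det {n : WithTop ℕ∞} {A : (Fin 4 → ℝ) → Matrix (Fin 4) (Fin 4) ℝ}
    (hA : ∀ i j, ContDiffOn ℝ n (fun y => A y i j) Ω) :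
    ContDiffOn ℝ n (fun y => (A y).det) Ω := by
  simp only [det_apply]
  exact .sum fun σ _ => (contDiffOn_prod fun i _ => hA _ _).const_smul _

theorem contDiffOn_hessDet (hΩ : IsOpen Ω) (hv : ContDiffOn ℝ 4 v Ω) :
    ContDiffOn ℝ 2 (hessDet v) Ω :=
  ContDiffOn.det fun i j => contDiffOn_pd2 hΩ hv i j

theorem contDiffOn_cofCol (hΩ : IsOpen Ω) (hv : ContDiffOn ℝ 4 v Ω) (m k : Fin 4) :
    ContDiffOn ℝ 2 (cofCol v m k) Ω := by
  have : cofCol v m k = fun y => ((hessM v y).updateRow m (Pi.single k 1)).det := by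
    ext y; rw [cofCol, adjugate_apply]
  rw [this]
  refine ContDiffOn.det fun i j => ?_
  by_cases hi : i = m
  · subst hi; simpa using contDiffOn_const
  · simp only [updateRow_ne hi]
    exact contDiffOn_pd2 hΩ hv i j

theorem hessM_isSymm (hΩ : IsOpen Ω) (hv : ContDiffOn ℝ 4 v Ω) (hx : x ∈ Ω) :
    (hessM v x).IsSymm := by
  ext i j
  exact pd_comm hΩ (hv.of_le (by norm_num)) j i hx

theorem hessM_posSemidef (hΩ : IsOpen Ω) (hv : ContDiffOn ℝ 4 v Ω) (hconv : ConvexOn ℝ Ω v)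
    (hx : x ∈ Ω) : (hessM v x).PosSemidef := by
  refine PosSemidef.of_dotProduct_mulVec_nonneg
    (by have h := (hessM_isSymm hΩ hv hx).eq; simpa [IsHermitian] using h) fun n => ?_
  have h := dirD_dirD_nonneg_of_convexOn n hΩ (hv.of_le (by norm_num)) hconv hx
  have e : star n ⬝ᵥ hessM v x *ᵥ n = dirD2 n v x := by
    simp only [dirD2, dotProduct, mulVec, Finset.mul_sum, hessM, of_apply, pd2, star_trivial]
    exact Finset.sum_congr rfl fun i _ => Finset.sum_congr rfl fun j _ => by ring
  rw [e]
  exact h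

theorem sum_hess_mul_cofCol (v : (Fin 4 → ℝ) → ℝ) (m l : Fin 4) (x : Fin 4 → ℝ) :
    ∑ k, pd (pd v l) k x * cofCol v m k x = if l = m then hessDet v x else 0 := by
  have h := congrFun (congrFun (mul_adjugate (hessM v x)) l) m
  rw [Matrix.mul_apply] at h
  simp only [Matrix.smul_apply, Matrix.one_apply, smul_eq_mul, mul_ite, mul_one, mul_zero] at h
  exact h

theorem dirD_pd (v : (Fin 4 → ℝ) → ℝ) (m l : Fin 4) (x : Fin 4 → ℝ) :
    dirD (fun k => cofCol v m k x) (pd v l) x = if l = m then hessDet v x else 0 := by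
  rw [← sum_hess_mul_cofCol]
  exact Finset.sum_congr rfl fun k _ => mul_comm _ _

theorem pd3_comm (hΩ : IsOpen Ω) (hv : ContDiffOn ℝ 4 v Ω) (i j k : Fin 4) :
    Set.EqOn (pd (pd (pd v i) j) k) (pd (pd (pd v i) k) j) Ω :=
  pd_comm hΩ ((contDiffOn_pd hΩ hv i).of_le (by norm_num)) j k

theorem pd3_comm_left (hΩ : IsOpen Ω) (hv : ContDiffOn ℝ 4 v Ω) (i j k : Fin 4) :
    Set.EqOn (pd (pd (pd v i) j) k) (pd (pd (pd v j) i) k) Ω :=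
  pd_congr hΩ (pd_comm hΩ (hv.of_le (by norm_num)) i j) k

theorem pd4_comm (hΩ : IsOpen Ω) (hv : ContDiffOn ℝ 4 v Ω) (i j k l : Fin 4) :
    Set.EqOn (pd (pd (pd (pd v i) j) k) l) (pd (pd (pd (pd v k) l) i) j) Ω := by
  intro y hy
  rw [pd_congr hΩ (pd3_comm hΩ hv i j k) l hy, pd_congr hΩ (pd3_comm_left hΩ hv i k j) l hy,
    pd_comm hΩ (contDiffOn_pd2 hΩ hv k i) j l hy, pd_congr hΩ (pd3_comm hΩ hv k i l) j hy]

theorem hessD_isSymm (hΩ : IsOpen Ω) (hv : ContDiffOn ℝ 4 v Ω) (m : Fin 4) (hx : x ∈ Ω) :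
    (hessD v m x).IsSymm := by
  ext i j
  simp only [hessD, transpose_apply, of_apply, dirD]
  exact Finset.sum_congr rfl fun k _ => by rw [pd3_comm_left hΩ hv j i k hx]

theorem hessD_apply (hΩ : IsOpen Ω) (hv : ContDiffOn ℝ 4 v Ω) (m i j : Fin 4) (hx : x ∈ Ω) :
    hessD v m x i j = ∑ k, pd (pd (pd v i) k) j x * cofCol v m k x := by
  simp only [hessD, of_apply, dirD]
  exact Finset.sum_congr rfl fun k _ => by rw [pd3_comm hΩ hv i j k hx, mul_comm]

theorem pd_sum_mul (hΩ : IsOpen Ω) {A B : Fin 4 → (Fin 4 → ℝ) → ℝ}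
    (hA : ∀ k, ContDiffOn ℝ 2 (A k) Ω) (hB : ∀ k, ContDiffOn ℝ 2 (B k) Ω) (i : Fin 4)
    (hx : x ∈ Ω) :
    pd (fun y => ∑ k, A k y * B k y) i x = ∑ k, (pd (A k) i x * B k x + A k x * pd (B k) i x) := by
  have h2 : (2 : WithTop ℕ∞) ≠ 0 := by norm_num
  rw [pd_sum i fun k => ((hA k).mul (hB k)).differentiableAt_of_isOpen hΩ h2 hx]
  exact Finset.sum_congr rfl fun k _ => pd_mul i ((hA k).differentiableAt_of_isOpen hΩ h2 hx)
    ((hB k).differentiableAt_of_isOpen hΩ h2 hx)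

theorem pd_pd_sum_mul (hΩ : IsOpen Ω) {A B : Fin 4 → (Fin 4 → ℝ) → ℝ}
    (hA : ∀ k, ContDiffOn ℝ 2 (A k) Ω) (hB : ∀ k, ContDiffOn ℝ 2 (B k) Ω) (i j : Fin 4)
    (hx : x ∈ Ω) :
    pd (pd (fun y => ∑ k, A k y * B k y) i) j x =
      ∑ k, (pd (pd (A k) i) j x * B k x + pd (A k) i x * pd (B k) j x
        + pd (A k) j x * pd (B k) i x + A k x * pd (pd (B k) i) j x) := by
  have h2 : (2 : WithTop ℕ∞) ≠ 0 := by norm_num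
  have hE : Set.EqOn (pd (fun y => ∑ k, A k y * B k y) i)
      (fun y => ∑ k, pd (fun y => A k y * B k y) i y) Ω := fun y hy =>
    pd_sum i fun k => ((hA k).mul (hB k)).differentiableAt_of_isOpen hΩ h2 hy
  rw [pd_congr hΩ hE j hx, pd_sum j fun k => (((hA k).mul (hB k)).pd hΩ (m := 1) (by norm_num)
    i).differentiableAt_of_isOpen hΩ one_ne_zero hx]
  exact Finset.sum_congr rfl fun k _ => pd2_mul hΩ (hA k) (hB k) i j hx

theorem pd_ite (p : Prop) [Decidable p] (f : (Fin 4 → ℝ) → ℝ) (i : Fin 4) :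
    pd (fun y => if p then f y else 0) i = fun y => if p then pd f i y else 0 := by
  ext y
  split_ifs
  · rfl
  · simp [pd]

/-- First derivative of the relation `H n = det(H) eₘ` for the cofactor column `n`. -/
theorem hessM_mul_cofColD (hΩ : IsOpen Ω) (hv : ContDiffOn ℝ 4 v Ω) (m : Fin 4) (hx : x ∈ Ω) :
    hessM v x * cofColD v m x = gradRow v m x - hessD v m x := by
  ext l i
  have h := pd_sum_mul hΩ (fun k => contDiffOn_pd2 hΩ hv l k) (contDiffOn_cofCol hΩ hv m) i hx
  simp only [sum_hess_mul_cofCol, pd_ite, Finset.sum_add_distrib] at h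
  rw [Matrix.sub_apply, hessD_apply hΩ hv m l i hx, Matrix.mul_apply]
  simp only [gradRow, of_apply, h, cofColD, hessM, pd2]
  ring

/-- Second derivative of the relation `H n = det(H) eₘ`, contracted with `n`. -/
theorem cofCol_smul_hess_hessDet (hΩ : IsOpen Ω) (hv : ContDiffOn ℝ 4 v Ω) (m : Fin 4)
    (hx : x ∈ Ω) :
    cofCol v m m x • (of fun i j => pd (pd (hessDet v) i) j x) =
      hessD2 v m x + (hessD v m x)ᵀ * cofColD v m x + ((hessD v m x)ᵀ * cofColD v m x)ᵀ
        + hessDet v x • cofDiagD2 v m x := by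
  ext i j
  have h : ∀ l, (if l = m then pd (pd (hessDet v) i) j x else 0) = _ := fun l => by
    have h := pd_pd_sum_mul hΩ (fun k => contDiffOn_pd2 hΩ hv l k) (contDiffOn_cofCol hΩ hv m)
      i j hx
    simpa only [sum_hess_mul_cofCol, pd_ite] using h
  have h1 : cofCol v m m x * pd (pd (hessDet v) i) j x =
      ∑ l, cofCol v m l x * (if l = m then pd (pd (hessDet v) i) j x else 0) := by simp
  have hsym : ∀ l k, pd (pd v l) k x = pd (pd v k) l x := fun l k =>
    pd_comm hΩ (hv.of_le (by norm_num)) l k hx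
  have h2 : hessDet v x * pd (pd (cofCol v m m) i) j x =
      ∑ k, (∑ l, pd (pd v k) l x * cofCol v m l x) * pd (pd (cofCol v m k) i) j x := by
    simp [sum_hess_mul_cofCol]
  have h4 : hessD2 v m x i j = ∑ l, ∑ k, cofCol v m l x * cofCol v m k x *
      pd (pd (pd (pd v l) k) i) j x := by
    simp only [hessD2, of_apply, dirD2]
    exact Finset.sum_congr rfl fun l _ => Finset.sum_congr rfl fun k _ => by
      rw [pd4_comm hΩ hv i j l k hx]
  have h3 : ∀ i k, hessD v m x k i = ∑ l, pd (pd (pd v l) k) i x * cofCol v m l x := fun i k => by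
    rw [hessD_apply hΩ hv m k i hx]
    exact Finset.sum_congr rfl fun l _ => by rw [pd3_comm_left hΩ hv k l i hx]
  simp only [Matrix.smul_apply, Matrix.add_apply, transpose_apply, Matrix.mul_apply, of_apply,
    smul_eq_mul, cofColD, cofDiagD2]
  rw [h1, h2, h4]
  simp only [h, h3, Fin.sum_univ_four]
  rw [hsym 1 0, hsym 2 0, hsym 3 0, hsym 2 1, hsym 3 1, hsym 3 2]
  ring

theorem gradSqD_apply (hΩ : IsOpen Ω) (hv : ContDiffOn ℝ 4 v Ω) (m i j : Fin 4) (hx : x ∈ Ω) :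
    gradSqD v m x i j = (if i = m then hessDet v x else 0) * pd v j x
      + pd v i x * (if j = m then hessDet v x else 0) := by
  have h3 : (3 : WithTop ℕ∞) ≠ 0 := by norm_num
  have hd := fun i => (contDiffOn_pd hΩ hv i).differentiableAt_of_isOpen hΩ h3 hx
  simp only [gradSqD, of_apply]
  rw [dirD_mul _ (hd i) (hd j), dirD_pd, dirD_pd]

theorem dirD2_pd (hΩ : IsOpen Ω) (hv : ContDiffOn ℝ 4 v Ω) (m i : Fin 4) (hx : x ∈ Ω) :
    dirD2 (fun k => cofCol v m k x) (pd v i) x =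
      cofCol v m m x * pd (hessDet v) i x - hessDet v x * cofColD v m x m i := by
  have h1 : dirD2 (fun k => cofCol v m k x) (pd v i) x =
      ∑ l, cofCol v m l x * hessD v m x l i := by
    simp only [dirD2, hessD, of_apply, dirD, Finset.mul_sum]
    refine Finset.sum_congr rfl fun l _ => Finset.sum_congr rfl fun k _ => ?_
    rw [pd3_comm_left hΩ hv l i k hx]
    ring
  have h2 : hessD v m x = gradRow v m x - hessM v x * cofColD v m x := by
    rw [hessM_mul_cofColD hΩ hv m hx]; abel
  have h3 : ∑ l, cofCol v m l x * (hessM v x * cofColD v m x) l i =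
      ∑ k, (∑ l, pd (pd v k) l x * cofCol v m l x) * cofColD v m x k i := by
    simp only [Matrix.mul_apply, Finset.mul_sum, Finset.sum_mul]
    rw [Finset.sum_comm]
    refine Finset.sum_congr rfl fun k _ => Finset.sum_congr rfl fun l _ => ?_
    rw [← (hessM_isSymm hΩ hv hx).apply]
    simp only [hessM, of_apply, pd2]
    ring
  rw [h1, h2]
  simp only [Matrix.sub_apply, mul_sub, Finset.sum_sub_distrib, h3, sum_hess_mul_cofCol]
  simp [gradRow]

theorem gradSqD2_apply (hΩ : IsOpen Ω) (hv : ContDiffOn ℝ 4 v Ω) (m i j : Fin 4) (hx : x ∈ Ω) :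
    gradSqD2 v m x i j =
      (cofCol v m m x * pd (hessDet v) i x - hessDet v x * cofColD v m x m i) * pd v j x
      + 2 * (if i = m then hessDet v x else 0) * (if j = m then hessDet v x else 0)
      + pd v i x *
        (cofCol v m m x * pd (hessDet v) j x - hessDet v x * cofColD v m x m j) := by
  have hd := fun i => (contDiffOn_pd hΩ hv i).of_le (m := 2) (by norm_num)
  simp only [gradSqD2, of_apply]
  rw [dirD2_mul _ hΩ (hd i) (hd j) hx, dirD_pd, dirD_pd, dirD2_pd hΩ hv m i hx,
    dirD2_pd hΩ hv m j hx]

end HessianDeterminant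

section ReducedHessian

open Matrix

variable {Ω : Set (Fin 4 → ℝ)} {v : (Fin 4 → ℝ) → ℝ} {x : Fin 4 → ℝ} {lam : ℝ}

/-- The entries of `∇²v - ∇v ⊗ ∇v`. -/
noncomputable def redHess (v : (Fin 4 → ℝ) → ℝ) (i j : Fin 4) (x : Fin 4 → ℝ) : ℝ :=
  pd (pd v i) j x - pd v i x * pd v j x

theorem contDiffOn_redHess (hΩ : IsOpen Ω) (hv : ContDiffOn ℝ 4 v Ω) (i j : Fin 4) :
    ContDiffOn ℝ 2 (redHess v i j) Ω :=
  have h := fun i => (contDiffOn_pd hΩ hv i).of_le (m := 2) (by norm_num)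
  (contDiffOn_pd2 hΩ hv i j).sub ((h i).mul (h j))

theorem dirD_redHess (hΩ : IsOpen Ω) (hv : ContDiffOn ℝ 4 v Ω) (m i j : Fin 4) (hx : x ∈ Ω) :
    dirD (fun k => cofCol v m k x) (redHess v i j) x = (hessD v m x - gradSqD v m x) i j := by
  have h := fun i => (contDiffOn_pd hΩ hv i).differentiableAt_of_isOpen hΩ (by norm_num) hx
  exact dirD_sub _ ((contDiffOn_pd2 hΩ hv i j).differentiableAt_of_isOpen hΩ (by norm_num) hx)
    ((h i).mul (h j))

theorem dirD2_redHess (hΩ : IsOpen Ω) (hv : ContDiffOn ℝ 4 v Ω) (m i j : Fin 4) (hx : x ∈ Ω) :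
    dirD2 (fun k => cofCol v m k x) (redHess v i j) x = (hessD2 v m x - gradSqD2 v m x) i j := by
  have h := fun i => (contDiffOn_pd hΩ hv i).of_le (m := 2) (by norm_num)
  exact dirD2_sub _ hΩ (contDiffOn_pd2 hΩ hv i j) ((h i).mul (h j)) hx

theorem gradSqD_isSymm (v : (Fin 4 → ℝ) → ℝ) (m : Fin 4) (x : Fin 4 → ℝ) :
    (gradSqD v m x).IsSymm := by
  ext i j
  simp only [gradSqD, transpose_apply, of_apply, mul_comm (pd v j _)]

theorem gradSqD2_isSymm (v : (Fin 4 → ℝ) → ℝ) (m : Fin 4) (x : Fin 4 → ℝ) :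
    (gradSqD2 v m x).IsSymm := by
  ext i j
  simp only [gradSqD2, transpose_apply, of_apply, mul_comm (pd v j _)]

theorem hessD2_isSymm (hΩ : IsOpen Ω) (hv : ContDiffOn ℝ 4 v Ω) (m : Fin 4) (hx : x ∈ Ω) :
    (hessD2 v m x).IsSymm := by
  ext i j
  have h := pd_comm hΩ (hv.of_le (by norm_num)) j i
  simp only [hessD2, transpose_apply, of_apply, dirD2]
  exact Finset.sum_congr rfl fun k _ => Finset.sum_congr rfl fun l _ => by
    rw [pd_congr hΩ (pd_congr hΩ h k) l hx]

theorem Fm_eq_hermReal (v : (Fin 4 → ℝ) → ℝ) (x : Fin 4 → ℝ) :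
    Fm v x = hermReal (redHess v 1 1 x + redHess v 3 3 x) (redHess v 0 0 x + redHess v 2 2 x)
      (-(redHess v 0 1 x + redHess v 2 3 x)) (-(redHess v 0 3 x - redHess v 1 2 x)) := by
  simp only [Fm, hermReal, redHess, pd2]
  congr 1
  ring_nf

theorem StarEq.redHess_eq (hstar : StarEq lam v Ω) (hx : x ∈ Ω) :
    (redHess v 1 1 x + redHess v 3 3 x) * (redHess v 0 0 x + redHess v 2 2 x)
      - (redHess v 0 1 x + redHess v 2 3 x) * (redHess v 0 1 x + redHess v 2 3 x)
      - (redHess v 0 3 x - redHess v 1 2 x) * (redHess v 0 3 x - redHess v 1 2 x) = lam := by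
  rw [← hstar x hx]
  simp only [redHess, pd2]
  ring

theorem dirD_eq_zero_of_det_const (hΩ : IsOpen Ω) {A B C D : (Fin 4 → ℝ) → ℝ} (n : Fin 4 → ℝ)
    (hA : ContDiffOn ℝ 2 A Ω) (hB : ContDiffOn ℝ 2 B Ω) (hC : ContDiffOn ℝ 2 C Ω)
    (hD : ContDiffOn ℝ 2 D Ω)
    (h : Set.EqOn (fun y => A y * B y - C y * C y - D y * D y) (fun _ => lam) Ω) (hx : x ∈ Ω) :
    A x * dirD n B x + B x * dirD n A x - 2 * C x * dirD n C x - 2 * D x * dirD n D x = 0 ∧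
    A x * dirD2 n B x + B x * dirD2 n A x - 2 * C x * dirD2 n C x - 2 * D x * dirD2 n D x
      + 2 * (dirD n A x * dirD n B x - dirD n C x ^ 2 - dirD n D x ^ 2) = 0 := by
  have hd := fun {f : (Fin 4 → ℝ) → ℝ} (hf : ContDiffOn ℝ 2 f Ω) =>
    hf.differentiableAt_of_isOpen hΩ (by norm_num) hx
  have h1 := dirD_congr_const n hΩ h hx
  have h2 := dirD2_congr_const n hΩ h hx
  rw [dirD_sub _ (hd ((hA.mul hB).sub (hC.mul hC))) (hd (hD.mul hD)),
    dirD_sub _ (hd (hA.mul hB)) (hd (hC.mul hC)), dirD_mul _ (hd hA) (hd hB),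
    dirD_mul _ (hd hC) (hd hC), dirD_mul _ (hd hD) (hd hD)] at h1
  rw [dirD2_sub _ hΩ ((hA.mul hB).sub (hC.mul hC)) (hD.mul hD) hx,
    dirD2_sub _ hΩ (hA.mul hB) (hC.mul hC) hx, dirD2_mul _ hΩ hA hB hx,
    dirD2_mul _ hΩ hC hC hx, dirD2_mul _ hΩ hD hD hx] at h2
  exact ⟨by linear_combination h1, by linear_combination h2⟩

/-- Equation (★) differentiated once and twice along the cofactor column. -/
theorem StarEq.trace_Fm_mul (hstar : StarEq lam v Ω) (hΩ : IsOpen Ω) (hv : ContDiffOn ℝ 4 v Ω)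
    (m : Fin 4) (hx : x ∈ Ω) :
    trace (Fm v x * (hessD v m x - gradSqD v m x)) = 0 ∧
    trace (Fm v x * (hessD2 v m x - gradSqD2 v m x))
      + 2 * hermDet (hessD v m x - gradSqD v m x) = 0 := by
  have hw := contDiffOn_redHess hΩ hv
  obtain ⟨h1, h2⟩ := dirD_eq_zero_of_det_const hΩ (fun k => cofCol v m k x)
    ((hw 1 1).add (hw 3 3)) ((hw 0 0).add (hw 2 2)) ((hw 0 1).add (hw 2 3))
    ((hw 0 3).sub (hw 1 2)) (fun y hy => hstar.redHess_eq hy) hx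
  have hd := fun i j => (hw i j).differentiableAt_of_isOpen hΩ (by norm_num) hx
  simp only [dirD_add _ (hd _ _) (hd _ _), dirD_sub _ (hd _ _) (hd _ _),
    dirD2_add _ hΩ (hw _ _) (hw _ _) hx, dirD2_sub _ hΩ (hw _ _) (hw _ _) hx,
    dirD_redHess hΩ hv m _ _ hx, dirD2_redHess hΩ hv m _ _ hx] at h1 h2
  have hs := ((hessD_isSymm hΩ hv m hx).sub (gradSqD_isSymm v m x)).apply
  have hs2 := ((hessD2_isSymm hΩ hv m hx).sub (gradSqD2_isSymm v m x)).apply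
  rw [Fm_eq_hermReal, trace_hermReal_mul, trace_hermReal_mul, hermDet, hs 0 1, hs 2 3, hs 0 3,
    hs 1 2, hs2 0 1, hs2 2 3, hs2 0 3, hs2 1 2]
  exact ⟨by linear_combination h1, by linear_combination h2⟩

/-- On a complex line orthogonal to the gradient, `∇v ⊗ ∇v` does not contribute. -/
theorem dotProduct_hermPart_hessM_mulVec (v : (Fin 4 → ℝ) → ℝ) (x : Fin 4 → ℝ) {q : Fin 4 → ℝ}
    (h1 : (fun i => pd v i x) ⬝ᵥ q = 0) (h2 : (fun i => pd v i x) ⬝ᵥ mulI q = 0) :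
    q ⬝ᵥ hermPart (hessM v x) *ᵥ q =
      q ⬝ᵥ hermReal (redHess v 0 0 x + redHess v 2 2 x) (redHess v 1 1 x + redHess v 3 3 x)
        (redHess v 0 1 x + redHess v 2 3 x) (redHess v 0 3 x - redHess v 1 2 x) *ᵥ q := by
  simp [dotProduct, Fin.sum_univ_four, mulI] at h1 h2
  simp [dotProduct, mulVec, Fin.sum_univ_four, hermPart, hermReal, hessM, redHess, pd2]
  linear_combination (pd v 0 x * q 0 + pd v 1 x * q 1 + pd v 2 x * q 2 + pd v 3 x * q 3) * h1
    + (-(pd v 0 x * q 2) - pd v 1 x * q 3 + pd v 2 x * q 0 + pd v 3 x * q 1) * h2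

end ReducedHessian
section DifferentialInequality

open Matrix Asymptotics Filter Topology

variable {Ω : Set (Fin 4 → ℝ)} {v : (Fin 4 → ℝ) → ℝ} {x : Fin 4 → ℝ} {lam : ℝ}

/-- The terms of the linearised operator applied to the Hessian determinant which are controlled
by the determinant and its gradient. -/
noncomputable def remainderTerm (v : (Fin 4 → ℝ) → ℝ) (m : Fin 4) (q : Fin 4 → ℝ) (s : ℝ)
    (x : Fin 4 → ℝ) : ℝ :=
  trace (Fm v x * gradSqD2 v m x)
    + 2 * (hermDet (hessD v m x) - hermDet (hessD v m x - gradSqD v m x))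
    + 2 * trace (Fm v x * ((cofColD v m x)ᵀ * gradRow v m x))
    + trace (Fm v x * cofDiagD2 v m x) * hessDet v x
    + 4 * trace (Fm v x * (s • (complexRankOne q (hermPart (hessD v m x) *ᵥ q))ᵀ
        * gradRow v m x))
    - 2 * (s * (q ⬝ᵥ hermPart (hessD v m x) *ᵥ q) * trace (Fm v x * gradSqD v m x))

theorem trace_Fm_mul_transpose (v : (Fin 4 → ℝ) → ℝ) (x : Fin 4 → ℝ)
    (K : Matrix (Fin 4) (Fin 4) ℝ) : trace (Fm v x * Kᵀ) = trace (Fm v x * K) := by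
  rw [Fm_eq_hermReal, trace_hermReal_mul, trace_hermReal_mul]
  simp only [transpose_apply]
  ring

/-- The inverse of the Hermitian Hessian along `q` is controlled. -/
theorem StarEq.pos_and_le (hstar : StarEq lam v Ω) (hlam : 0 < lam) (hΩ : IsOpen Ω)
    (hv : ContDiffOn ℝ 4 v Ω) (hconv : ConvexOn ℝ Ω v) (hx : x ∈ Ω) {q : Fin 4 → ℝ}
    (hq : q ⬝ᵥ q = 1) (h1 : (fun i => pd v i x) ⬝ᵥ q = 0)
    (h2 : (fun i => pd v i x) ⬝ᵥ mulI q = 0) :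
    0 < Fm v x 0 0 ∧ 0 < Fm v x 1 1 ∧
      lam ≤ (Fm v x 0 0 + Fm v x 1 1) * (q ⬝ᵥ hermPart (hessM v x) *ᵥ q) := by
  have hH := hessM_posSemidef hΩ hv hconv hx
  have hnn : 0 ≤ q ⬝ᵥ hermPart (hessM v x) *ᵥ q := by
    rw [dotProduct_hermPart_mulVec (hessM_isSymm hΩ hv hx)]
    exact add_nonneg (hH.dotProduct_mulVec_nonneg q) (hH.dotProduct_mulVec_nonneg (mulI q))
  have hE := hstar.redHess_eq hx
  have hW := dotProduct_hermPart_hessM_mulVec v x h1 h2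
  rw [hW] at hnn
  obtain ⟨hb, ha, hle⟩ := pos_of_dotProduct_nonneg (by linarith) hq hnn
  rw [← hW] at hle
  rw [Fm_eq_hermReal]
  refine ⟨ha, hb, ?_⟩
  change lam ≤ (redHess v 1 1 x + redHess v 3 3 x + (redHess v 0 0 x + redHess v 2 2 x)) * _
  linarith

theorem StarEq.cofCol_mul_trace_le (hstar : StarEq lam v Ω) (hlam : 0 < lam) (hΩ : IsOpen Ω)
    (hv : ContDiffOn ℝ 4 v Ω) (hconv : ConvexOn ℝ Ω v) (m : Fin 4) (hx : x ∈ Ω) {q : Fin 4 → ℝ}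
    (hq : q ⬝ᵥ q = 1) (h1 : (fun i => pd v i x) ⬝ᵥ q = 0)
    (h2 : (fun i => pd v i x) ⬝ᵥ mulI q = 0) :
    cofCol v m m x * trace (Fm v x * of fun i j => pd (pd (hessDet v) i) j x) ≤
      remainderTerm v m q (q ⬝ᵥ hermPart (hessM v x) *ᵥ q)⁻¹ x := by
  obtain ⟨ha, hb, hle⟩ := hstar.pos_and_le hlam hΩ hv hconv hx hq h1 h2
  have hpos : 0 < q ⬝ᵥ hermPart (hessM v x) *ᵥ q :=
    pos_of_mul_pos_right (hlam.trans_le hle) (add_pos ha hb).le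
  have hH := hessM_posSemidef hΩ hv hconv hx
  have hHs := hessM_isSymm hΩ hv hx
  have hXs := hessD_isSymm hΩ hv m hx
  obtain ⟨hs1, hs2⟩ := hstar.trace_Fm_mul hΩ hv m hx
  have hE := hstar.redHess_eq hx
  have hHU := hessM_mul_cofColD hΩ hv m hx
  have ha' : 0 < redHess v 1 1 x + redHess v 3 3 x := by rwa [Fm_eq_hermReal] at ha
  have key := neg_trace_conj_le (c := -(redHess v 0 1 x + redHess v 2 3 x))
    (d := -(redHess v 0 3 x - redHess v 1 2 x)) (b := redHess v 0 0 x + redHess v 2 2 x)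
    ha' (by linarith) hH hXs hHU q (inv_mul_cancel₀ hpos.ne')
    (by simpa only [neg_neg] using dotProduct_hermPart_hessM_mulVec v x h1 h2)
  rw [← Fm_eq_hermReal, transpose_smul] at key
  have hsec := congrArg (fun M => trace (Fm v x * M)) (cofCol_smul_hess_hessDet hΩ hv m hx)
  have hXU : trace (Fm v x * ((hessD v m x)ᵀ * cofColD v m x)) =
      trace (Fm v x * ((cofColD v m x)ᵀ * gradRow v m x))
        - trace (Fm v x * ((cofColD v m x)ᵀ * hessM v x * cofColD v m x)) := by
    have hX : hessD v m x = gradRow v m x - hessM v x * cofColD v m x := by rw [hHU]; abel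
    rw [← trace_Fm_mul_transpose, transpose_mul, transpose_transpose]
    conv_lhs => rw [hX]
    rw [Matrix.mul_sub, Matrix.mul_sub, trace_sub, Matrix.mul_assoc (cofColD v m x)ᵀ]
  simp only [Matrix.mul_add, trace_add, Matrix.mul_smul, trace_smul, smul_eq_mul,
    trace_Fm_mul_transpose] at hsec
  rw [Matrix.mul_sub, trace_sub] at hs1 hs2
  rw [hsec, hXU, remainderTerm]
  have hX1 : trace (Fm v x * hessD v m x) = trace (Fm v x * gradSqD v m x) := by linarith
  rw [hX1] at key
  linarith

/-- The quantity `φ + |∇φ|` for the Hessian determinant `φ`. -/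
noncomputable def hessDetSize (v : (Fin 4 → ℝ) → ℝ) (x : Fin 4 → ℝ) : ℝ :=
  hessDet v x + Real.sqrt (∑ i : Fin 4, pd (hessDet v) i x ^ 2)

theorem ContDiffOn.isBigO_one (hΩ : IsOpen Ω) {n : WithTop ℕ∞} {f : (Fin 4 → ℝ) → ℝ}
    (hf : ContDiffOn ℝ n f Ω) (hx : x ∈ Ω) : f =O[𝓝 x] (1 : (Fin 4 → ℝ) → ℝ) :=
  (hf.continuousOn.continuousAt (hΩ.mem_nhds hx)).isBigO_one ℝ

theorem hessDet_nonneg (hΩ : IsOpen Ω) (hv : ContDiffOn ℝ 4 v Ω) (hconv : ConvexOn ℝ Ω v)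
    (hx : x ∈ Ω) : 0 ≤ hessDet v x := (hessM_posSemidef hΩ hv hconv hx).det_nonneg

theorem isBigO_hessDet (hΩ : IsOpen Ω) (hv : ContDiffOn ℝ 4 v Ω) (hconv : ConvexOn ℝ Ω v)
    (hx : x ∈ Ω) : hessDet v =O[𝓝 x] hessDetSize v := by
  refine .of_bound 1 ?_
  filter_upwards [hΩ.mem_nhds hx] with y hy
  have h := hessDet_nonneg hΩ hv hconv hy
  have h' := Real.sqrt_nonneg (∑ i : Fin 4, pd (hessDet v) i y ^ 2)
  rw [Real.norm_of_nonneg h, hessDetSize, Real.norm_of_nonneg (add_nonneg h h')]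
  linarith

theorem isBigO_pd_hessDet (hΩ : IsOpen Ω) (hv : ContDiffOn ℝ 4 v Ω) (hconv : ConvexOn ℝ Ω v)
    (hx : x ∈ Ω) (i : Fin 4) : pd (hessDet v) i =O[𝓝 x] hessDetSize v := by
  refine .of_bound 1 ?_
  filter_upwards [hΩ.mem_nhds hx] with y hy
  have h := hessDet_nonneg hΩ hv hconv hy
  have h' := Real.sqrt_nonneg (∑ i : Fin 4, pd (hessDet v) i y ^ 2)
  have h2 : |pd (hessDet v) i y| ≤ Real.sqrt (∑ i : Fin 4, pd (hessDet v) i y ^ 2) :=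
    Real.abs_le_sqrt (Finset.single_le_sum (f := fun i => pd (hessDet v) i y ^ 2)
      (fun j _ => sq_nonneg _) (Finset.mem_univ i))
  rw [hessDetSize, Real.norm_of_nonneg (add_nonneg h h'), Real.norm_eq_abs]
  linarith

theorem isBigO_remainderTerm (hΩ : IsOpen Ω) (hv : ContDiffOn ℝ 4 v Ω) (hconv : ConvexOn ℝ Ω v)
    (m : Fin 4) (hx : x ∈ Ω) {q : (Fin 4 → ℝ) → Fin 4 → ℝ} {s : (Fin 4 → ℝ) → ℝ}
    (hq : ∀ i, (fun y => q y i) =O[𝓝 x] (1 : (Fin 4 → ℝ) → ℝ))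
    (hs : s =O[𝓝 x] (1 : (Fin 4 → ℝ) → ℝ)) :
    (fun y => remainderTerm v m (q y) (s y) y) =O[𝓝 x] hessDetSize v := by
  have hφ := isBigO_hessDet hΩ hv hconv hx
  have hdφ := isBigO_pd_hessDet hΩ hv hconv hx
  have hΩx := hΩ.mem_nhds hx
  have hp := fun i => (contDiffOn_pd hΩ hv i).isBigO_one hΩ hx
  have hN := contDiffOn_cofCol hΩ hv m
  have hN1 := fun k => (hN k).isBigO_one hΩ hx
  have hU : ∀ i j, (fun y => cofColD v m y i j) =O[𝓝 x] (1 : (Fin 4 → ℝ) → ℝ) := fun i j =>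
    ((hN i).pd hΩ (m := 1) (by norm_num) j).isBigO_one hΩ hx
  have hN2 : ∀ i j, (fun y => cofDiagD2 v m y i j) =O[𝓝 x] (1 : (Fin 4 → ℝ) → ℝ) := fun i j =>
    (((hN m).pd hΩ (m := 1) (by norm_num) i).pd hΩ (m := 0) (by norm_num) j).isBigO_one hΩ hx
  have hX : ∀ i j, (fun y => hessD v m y i j) =O[𝓝 x] (1 : (Fin 4 → ℝ) → ℝ) := fun i j => by
    simp only [hessD, of_apply, dirD]
    exact .fun_sum fun k _ =>
      (hN1 k).bdd_mul ((contDiffOn_pd3 hΩ hv i j k).isBigO_one hΩ hx)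
  have hF : ∀ i j, (fun y => Fm v y i j) =O[𝓝 x] (1 : (Fin 4 → ℝ) → ℝ) := fun i j => by
    simp only [Fm_eq_hermReal]
    have hw := fun i j => (contDiffOn_redHess hΩ hv i j).isBigO_one hΩ hx
    exact isBigO_hermReal ((hw _ _).add (hw _ _)) ((hw _ _).add (hw _ _))
      ((hw _ _).add (hw _ _)).neg_left ((hw _ _).sub (hw _ _)).neg_left i j
  have hite : ∀ {f : (Fin 4 → ℝ) → ℝ} (P : Prop) [Decidable P], f =O[𝓝 x] hessDetSize v →
      (fun y => if P then f y else 0) =O[𝓝 x] hessDetSize v := fun P _ hf => by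
    by_cases hP : P
    · simpa [hP] using hf
    · simpa [hP] using isBigO_zero _ _
  have hE : ∀ i j, (fun y => gradRow v m y i j) =O[𝓝 x] hessDetSize v := fun i j =>
    hite _ (hdφ j)
  have hP1 : ∀ i j, (fun y => gradSqD v m y i j) =O[𝓝 x] hessDetSize v := fun i j => by
    refine IsBigO.congr' ?_ (mem_of_superset hΩx fun y hy =>
      (gradSqD_apply hΩ hv m i j hy).symm) EventuallyEq.rfl
    refine IsBigO.add ?_ ((hp i).bdd_mul (hite _ hφ))
    simpa only [mul_comm] using (hp j).bdd_mul (hite (i = m) hφ)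
  have hφ1 := (contDiffOn_hessDet hΩ hv).isBigO_one hΩ hx
  have hP1b : ∀ i j, (fun y => gradSqD v m y i j) =O[𝓝 x] (1 : (Fin 4 → ℝ) → ℝ) := fun i j => by
    simp only [gradSqD, of_apply, dirD]
    refine .fun_sum fun k _ => (hN1 k).bdd_mul ?_
    exact (((contDiffOn_pd hΩ hv i).mul (contDiffOn_pd hΩ hv j)).pd hΩ (m := 2) (by norm_num)
      k).isBigO_one hΩ hx
  have hP2 : ∀ i j, (fun y => gradSqD2 v m y i j) =O[𝓝 x] hessDetSize v := fun i j => by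
    refine IsBigO.congr' ?_ (mem_of_superset hΩx fun y hy =>
      (gradSqD2_apply hΩ hv m i j hy).symm) EventuallyEq.rfl
    have hD : ∀ i, (fun y => cofCol v m m y * pd (hessDet v) i y
        - hessDet v y * cofColD v m y m i) =O[𝓝 x] hessDetSize v := fun i => by
      refine ((hN1 m).bdd_mul (hdφ i)).sub ?_
      simpa only [mul_comm] using (hU m i).bdd_mul hφ
    refine (IsBigO.add ?_ ?_).add ((hp i).bdd_mul (hD j))
    · simpa only [mul_comm] using (hp j).bdd_mul (hD i)
    · refine IsBigO.bdd_mul (IsBigO.const_mul_left ?_ 2) (hite _ hφ)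
      by_cases hi : i = m
      · simpa [hi] using hφ1
      · simpa [hi] using isBigO_zero _ _
  have hXq : ∀ i, (fun y => (hermPart (hessD v m y) *ᵥ q y) i) =O[𝓝 x]
      (1 : (Fin 4 → ℝ) → ℝ) := isBigO_mulVec_apply (isBigO_hermPart hX) hq
  unfold remainderTerm
  refine ((((IsBigO.add ?_ ?_).add ?_).add ?_).add ?_).sub ?_
  · exact isBigO_trace_mul hF hP2
  · exact (isBigO_hermDet_sub hX hP1b hP1).const_mul_left 2
  · exact (isBigO_trace_mul hF (isBigO_mul_apply (fun i j => hU j i) hE)).const_mul_left 2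
  · exact (isBigO_trace_mul hF hN2).bdd_mul hφ
  · refine (isBigO_trace_mul hF (isBigO_mul_apply (fun i j => ?_) hE)).const_mul_left 4
    exact hs.bdd_mul (isBigO_complexRankOne hq hXq j i)
  · refine (IsBigO.bdd_mul (hs.bdd_mul ?_) (isBigO_trace_mul hF hP1)).const_mul_left 2
    simp only [dotProduct]
    exact .fun_sum fun i _ => (hq i).bdd_mul (hXq i)

theorem abs_apply_le_one_of_dotProduct_self {q : Fin 4 → ℝ} (hq : q ⬝ᵥ q = 1) (i : Fin 4) :
    |q i| ≤ 1 := by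
  have h : q i * q i ≤ q ⬝ᵥ q := Finset.single_le_sum (f := fun i => q i * q i)
    (fun j _ => mul_self_nonneg _) (Finset.mem_univ i)
  exact abs_le_one_iff_mul_self_le_one.2 (h.trans hq.le)

end DifferentialInequality

open Matrix Asymptotics Filter Topology

/-- differential inequality for `φ = det(∇²v)` when the minimal
rank of the Hessian is `3`. -/
theorem diff_ineq_minimal_rank_three
    (Ω : Set (Fin 4 → ℝ)) (hΩ : IsOpen Ω) (hconn : IsConnected Ω)
    (lam : ℝ) (hlam : 0 < lam)
    (v : (Fin 4 → ℝ) → ℝ) (hv : ContDiffOn ℝ 4 v Ω)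
    (hconv : ConvexOn ℝ Ω v)
    (hstar : StarEq lam v Ω)
    (x₀ : Fin 4 → ℝ) (hx₀ : x₀ ∈ Ω)
    (hrank : ∀ x ∈ Ω, 3 ≤ (hessM v x).rank)
    (hmin : (hessM v x₀).rank = 3) :
    ∃ O : Set (Fin 4 → ℝ), IsOpen O ∧ x₀ ∈ O ∧ O ⊆ Ω ∧
      ∃ C : ℝ, 0 < C ∧
        ∀ x ∈ O,
          ∑ i : Fin 4, ∑ j : Fin 4,
              Fm v x i j * pd2 (fun y => (hessM v y).det) i j x ≤
            C * ((hessM v x).det +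
              Real.sqrt (∑ i : Fin 4, (pd (fun y => (hessM v y).det) i x)^2)) := by
  obtain ⟨m, hm⟩ := exists_adjugate_diag_pos (hessM_posSemidef hΩ hv hconv hx₀) hmin
  choose q hq h1 h2 using fun x => exists_unit_complex_orthogonal fun i => pd v i x
  have hΩx := hΩ.mem_nhds hx₀
  have hqO : ∀ i, (fun y => q y i) =O[𝓝 x₀] (1 : (Fin 4 → ℝ) → ℝ) := fun i =>
    .of_bound 1 (.of_forall fun y => by
      simpa using abs_apply_le_one_of_dotProduct_self (hq y) i)
  have hFO : (fun y => (Fm v y 0 0 + Fm v y 1 1) * lam⁻¹) =O[𝓝 x₀]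
      (1 : (Fin 4 → ℝ) → ℝ) := by
    have hw := contDiffOn_redHess hΩ hv
    simp only [Fm_eq_hermReal]
    exact ((((hw 1 1).add (hw 3 3)).add ((hw 0 0).add (hw 2 2))).mul
      contDiffOn_const).isBigO_one hΩ hx₀
  have hsO : (fun y => (q y ⬝ᵥ hermPart (hessM v y) *ᵥ q y)⁻¹) =O[𝓝 x₀]
      (1 : (Fin 4 → ℝ) → ℝ) := by
    refine IsBigO.trans (.of_bound 1 ?_) hFO
    filter_upwards [hΩx] with y hy
    obtain ⟨ha, hb, hle⟩ := hstar.pos_and_le hlam hΩ hv hconv hy (hq y) (h1 y) (h2 y)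
    have hpos := pos_of_mul_pos_right (hlam.trans_le hle) (add_pos ha hb).le
    rw [Real.norm_of_nonneg (inv_pos.2 hpos).le,
      Real.norm_of_nonneg (mul_pos (add_pos ha hb) (inv_pos.2 hlam)).le, one_mul,
      ← div_eq_mul_inv, le_div_iff₀ hlam, inv_mul_le_iff₀ hpos, mul_comm]
    exact hle
  obtain ⟨K, hK, hR⟩ := (isBigO_remainderTerm hΩ hv hconv m hx₀ hqO hsO).exists_pos
  have hN : ∀ᶠ y in 𝓝 x₀, (hessM v x₀).adjugate m m / 2 < cofCol v m m y :=
    ((contDiffOn_cofCol hΩ hv m m).continuousOn.continuousAt hΩx).eventually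
      (lt_mem_nhds (half_lt_self hm))
  obtain ⟨O, hO, hOo, hxO⟩ := eventually_nhds_iff.1 ((hR.bound.and hN).and
    (show ∀ᶠ y in 𝓝 x₀, y ∈ Ω from hΩx))
  set c := (hessM v x₀).adjugate m m / 2
  have hc : 0 < c := half_pos hm
  refine ⟨O, hOo, hxO, fun y hy => (hO y hy).2, K / c, div_pos hK hc, fun y hy => ?_⟩
  obtain ⟨⟨hRy, hNy⟩, hyΩ⟩ := hO y hy
  have hle := hstar.cofCol_mul_trace_le hlam hΩ hv hconv m hyΩ (hq y) (h1 y) (h2 y)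
  have hsum : ∑ i : Fin 4, ∑ j : Fin 4, Fm v y i j * pd2 (fun y => (hessM v y).det) i j y =
      trace (Fm v y * of fun i j => pd (pd (hessDet v) i) j y) := by
    rw [← trace_Fm_mul_transpose]
    rfl
  have hψ : 0 ≤ hessDetSize v y := add_nonneg (hessDet_nonneg hΩ hv hconv hyΩ) (Real.sqrt_nonneg _)
  rw [Real.norm_of_nonneg hψ] at hRy
  have hbd := hle.trans ((le_abs_self _).trans hRy)
  change _ ≤ K / c * hessDetSize v y
  rw [hsum, div_mul_eq_mul_div, le_div_iff₀ hc]
  set T := trace (Fm v y * of fun i j => pd (pd (hessDet v) i) j y)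
  rcases le_total T 0 with hT | hT
  · exact (mul_nonpos_of_nonpos_of_nonneg hT hc.le).trans (mul_nonneg hK.le hψ)
  · nlinarith
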